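/- Let α < −1 and fix m_P ≠ m_Q and σ_P ≥ 0. Let (r', s') be given by the formulas in the context with σ_Q = 0, and for σ_Q > 0 let (r, s) be given by the same formulas. Then there exists σ_Q > 0 such that d_A^{(α)}(r‖s) > d_A^{(α)}(r'‖s'). -/

import Mathlib

open MeasureTheory Real Set

/-- `v := (1/(2|a|))√((σ_Q²−σ_P²)² + 2a²(σ_P²+σ_Q²) + a⁴)` with `a = m_P − m_Q`. -/
noncomputable def vParam (mP mQ σP σQ : ℝ) : ℝ :=
  (1 / (2 * |mP - mQ|)) *
    Real.sqrt ((σQ ^ 2 - σP ^ 2) ^ 2 + 2 * (mP - mQ) ^ 2 * (σP ^ 2 + σQ ^ 2) + (mP - mQ) ^ 4)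

/-- `r := 1/2 + (σ_Q²−σ_P²+a²)/(4av)`. -/
noncomputable def rParam (mP mQ σP σQ : ℝ) : ℝ :=
  1 / 2 + (σQ ^ 2 - σP ^ 2 + (mP - mQ) ^ 2) / (4 * (mP - mQ) * vParam mP mQ σP σQ)

/-- `s := 1/2 + (σ_Q²−σ_P²−a²)/(4av)`. -/
noncomputable def sParam (mP mQ σP σQ : ℝ) : ℝ :=
  1 / 2 + (σQ ^ 2 - σP ^ 2 - (mP - mQ) ^ 2) / (4 * (mP - mQ) * vParam mP mQ σP σQ)

/-- The binary `α`-divergence `d_A^{(α)}(r‖s)` for `α ≠ 0, 1`, with the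
convention `0^β = 0` for `β > 0` (as given by the real power function). -/
noncomputable def dA (α r s : ℝ) : ℝ :=
  (α * (α - 1))⁻¹ *
    (r ^ α * s ^ (1 - α) + (1 - r) ^ α * (1 - s) ^ (1 - α) - 1)

/-- The rescaled root `2|a|v` in terms of `b = a²`, `p = σ_P²`, `q = σ_Q²`. -/
noncomputable def rootParam (b p q : ℝ) : ℝ :=
  √((q - p) ^ 2 + 2 * b * (p + q) + b ^ 2)

/-- The parameter `r` for `a > 0` in terms of `b = a²`, `p = σ_P²`, `q = σ_Q²`. -/
noncomputable def rAux (b p q : ℝ) : ℝ := 1 / 2 + (q - p + b) / (2 * rootParam b p q)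

/-- The parameter `s` for `a > 0` in terms of `b = a²`, `p = σ_P²`, `q = σ_Q²`. -/
noncomputable def sAux (b p q : ℝ) : ℝ := 1 / 2 + (q - p - b) / (2 * rootParam b p q)

lemma rootParam_pos {b p q : ℝ} (hb : 0 < b) (hp : 0 ≤ p) (hq : 0 ≤ q) :
    0 < rootParam b p q :=
  Real.sqrt_pos.2 (by positivity)

lemma rootParam_zero {b p : ℝ} (hb : 0 < b) (hp : 0 ≤ p) : rootParam b p 0 = p + b := by
  rw [rootParam, ← Real.sqrt_sq (by positivity : 0 ≤ p + b)]
  congr 1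
  ring

lemma abs_div_two_mul_le_half {x w : ℝ} (hw : 0 < w) (h : |x| ≤ w) : |x / (2 * w)| ≤ 1 / 2 := by
  rw [abs_div, abs_of_pos (by positivity : 0 < 2 * w), div_le_iff₀ (by positivity)]
  linarith

lemma rAux_mem_Icc {b p q : ℝ} (hb : 0 < b) (hp : 0 ≤ p) (hq : 0 ≤ q) :
    rAux b p q ∈ Icc (0 : ℝ) 1 := by
  have h : |q - p + b| ≤ rootParam b p q :=
    Real.abs_le_sqrt (by nlinarith [mul_nonneg hb.le hp])
  have := abs_le.1 (abs_div_two_mul_le_half (rootParam_pos hb hp hq) h)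
  constructor <;> unfold rAux <;> linarith

lemma sAux_mem_Icc {b p q : ℝ} (hb : 0 < b) (hp : 0 ≤ p) (hq : 0 ≤ q) :
    sAux b p q ∈ Icc (0 : ℝ) 1 := by
  have h : |q - p - b| ≤ rootParam b p q :=
    Real.abs_le_sqrt (by nlinarith [mul_nonneg hb.le hq])
  have := abs_le.1 (abs_div_two_mul_le_half (rootParam_pos hb hp hq) h)
  constructor <;> unfold sAux <;> linarith

lemma rAux_zero {b p : ℝ} (hb : 0 < b) (hp : 0 ≤ p) : rAux b p 0 = b / (p + b) := by
  have : p + b ≠ 0 := by positivity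
  rw [rAux, rootParam_zero hb hp]
  field_simp
  ring

lemma sAux_zero {b p : ℝ} (hb : 0 < b) (hp : 0 ≤ p) : sAux b p 0 = 0 := by
  have : p + b ≠ 0 := by positivity
  rw [sAux, rootParam_zero hb hp]
  field_simp
  ring

lemma dA_one_sub (α r s : ℝ) : dA α (1 - r) (1 - s) = dA α r s := by
  simp only [dA, sub_sub_cancel]
  ring

lemma vParam_eq (mP mQ σP σQ : ℝ) :
    vParam mP mQ σP σQ =
      1 / (2 * |mP - mQ|) * rootParam ((mP - mQ) ^ 2) (σP ^ 2) (σQ ^ 2) := by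
  rw [vParam, rootParam]
  congr 3
  ring

lemma dA_rParam_sParam {mP mQ : ℝ} (hm : mP ≠ mQ) (α σP σQ : ℝ) :
    dA α (rParam mP mQ σP σQ) (sParam mP mQ σP σQ) =
      dA α (rAux ((mP - mQ) ^ 2) (σP ^ 2) (σQ ^ 2)) (sAux ((mP - mQ) ^ 2) (σP ^ 2) (σQ ^ 2)) := by
  have ha := sub_ne_zero.2 hm
  have hw := rootParam_pos (by positivity : 0 < (mP - mQ) ^ 2) (sq_nonneg σP) (sq_nonneg σQ)
  rcases ha.lt_or_gt with h | h
  · have hv : 4 * (mP - mQ) * vParam mP mQ σP σQ =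
        -(2 * rootParam ((mP - mQ) ^ 2) (σP ^ 2) (σQ ^ 2)) := by
      rw [vParam_eq, abs_of_neg h]
      field_simp
      ring
    rw [← dA_one_sub, rParam, sParam, hv, rAux, sAux, div_neg, div_neg]
    congr 1 <;> ring
  · have hv : 4 * (mP - mQ) * vParam mP mQ σP σQ =
        2 * rootParam ((mP - mQ) ^ 2) (σP ^ 2) (σQ ^ 2) := by
      rw [vParam_eq, abs_of_pos h]
      field_simp
      ring
    rw [rParam, sParam, hv, rAux, sAux]

lemma hasDerivAt_rootParam_zero {b p : ℝ} (hb : 0 < b) (hp : 0 ≤ p) :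
    HasDerivAt (rootParam b p) ((b - p) / (p + b)) 0 := by
  have h : HasDerivAt (fun q : ℝ => (q - p) ^ 2 + 2 * b * (p + q) + b ^ 2)
      (2 * (b - p)) 0 := by
    have h1 := (((hasDerivAt_id (0 : ℝ)).sub_const p).pow 2).add
      (((hasDerivAt_id (0 : ℝ)).const_add p).const_mul (2 * b))
    refine (h1.add_const (b ^ 2)).congr_deriv ?_
    simp
    ring
  refine (h.sqrt (by positivity)).congr_deriv ?_
  change 2 * (b - p) / (2 * rootParam b p 0) = _
  rw [rootParam_zero hb hp, mul_div_mul_left _ _ two_ne_zero]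

lemma hasDerivAt_rAux_zero {b p : ℝ} (hb : 0 < b) (hp : 0 ≤ p) :
    HasDerivAt (rAux b p) (2 * p * b / (p + b) ^ 3) 0 := by
  have hw : 2 * rootParam b p 0 ≠ 0 := (mul_pos two_pos (rootParam_pos hb hp le_rfl)).ne'
  have hA : p + b ≠ 0 := by positivity
  refine (((((hasDerivAt_id (0 : ℝ)).sub_const p).add_const b).fun_div
    ((hasDerivAt_rootParam_zero hb hp).const_mul 2) hw).const_add (1 / 2)).congr_deriv ?_
  simp only [id, rootParam_zero hb hp]
  field_simp
  ring

lemma hasDerivAt_sAux_zero {b p : ℝ} (hb : 0 < b) (hp : 0 ≤ p) :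
    HasDerivAt (sAux b p) (b / (p + b) ^ 2) 0 := by
  have hw : 2 * rootParam b p 0 ≠ 0 := (mul_pos two_pos (rootParam_pos hb hp le_rfl)).ne'
  have hA : p + b ≠ 0 := by positivity
  refine (((((hasDerivAt_id (0 : ℝ)).sub_const p).sub_const b).fun_div
    ((hasDerivAt_rootParam_zero hb hp).const_mul 2) hw).const_add (1 / 2)).congr_deriv ?_
  simp only [id, rootParam_zero hb hp]
  field_simp
  ring

lemma exists_gt_of_hasDerivAt_pos {f : ℝ → ℝ} {x f' : ℝ} (hf : HasDerivAt f f' x) (hf' : 0 < f') :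
    ∃ y, x < y ∧ f x < f y := by
  have h := (hasDerivAt_iff_tendsto_slope.1 hf).eventually (lt_mem_nhds hf')
  obtain ⟨y, hy, hxy⟩ :=
    ((h.filter_mono (nhdsGT_le_nhdsNE x)).and self_mem_nhdsWithin).exists
  exact ⟨y, hxy, (slope_pos_iff_of_le (le_of_lt hxy)).1 hy⟩

lemma exists_pos_rpow_mul_rpow_lt {α b p : ℝ} (hα : α < -1) (hb : 0 < b) (hp : 0 < p) :
    ∃ q, 0 < q ∧ (1 - rAux b p 0) ^ α * (1 - sAux b p 0) ^ (1 - α) <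
      (1 - rAux b p q) ^ α * (1 - sAux b p q) ^ (1 - α) := by
  have hr : 1 - rAux b p 0 = p / (p + b) := by
    rw [rAux_zero hb hp.le]
    field_simp
    ring
  have hs : 1 - sAux b p 0 = 1 := by rw [sAux_zero hb hp.le, sub_zero]
  have hpb : 0 < p / (p + b) := by positivity
  have h1 := ((hasDerivAt_rAux_zero hb hp.le).const_sub 1).rpow_const (p := α)
    (.inl (by rw [hr]; exact hpb.ne'))
  have h2 := ((hasDerivAt_sAux_zero hb hp.le).const_sub 1).rpow_const (p := 1 - α)
    (.inl (by rw [hs]; exact one_ne_zero))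
  refine exists_gt_of_hasDerivAt_pos (h1.mul h2) ?_
  simp only [hr, hs, Real.one_rpow, mul_one, Real.rpow_sub_one hpb.ne']
  have hX : 0 < (p / (p + b)) ^ α := Real.rpow_pos_of_pos hpb α
  have : 0 < (-α - 1) * ((p / (p + b)) ^ α * (b / (p + b) ^ 2)) :=
    mul_pos (by linarith) (by positivity)
  convert this using 1
  field_simp
  ring

lemma exists_pos_dA_lt {α b p : ℝ} (hα : α < -1) (hb : 0 < b) (hp : 0 ≤ p) :
    ∃ q, 0 < q ∧ dA α (rAux b p 0) (sAux b p 0) < dA α (rAux b p q) (sAux b p q) := by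
  have hc : 0 < (α * (α - 1))⁻¹ := inv_pos.2 (by nlinarith)
  have hz : (rAux b p 0) ^ α * (sAux b p 0) ^ (1 - α) = 0 := by
    rw [sAux_zero hb hp, Real.zero_rpow (by linarith), mul_zero]
  rcases hp.eq_or_lt with rfl | hp
  · refine ⟨1, one_pos, mul_lt_mul_of_pos_left ?_ hc⟩
    have hr0 : 1 - rAux b 0 0 = 0 := by
      rw [rAux_zero hb le_rfl, zero_add, div_self hb.ne', sub_self]
    have hw := rootParam_pos hb le_rfl zero_le_one
    have hw' : rootParam b 0 1 = 1 + b := by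
      rw [rootParam, ← Real.sqrt_sq (by positivity : 0 ≤ 1 + b)]
      congr 1
      ring
    have hr : rAux b 0 1 = 1 := by
      rw [rAux, hw']
      field_simp
      ring
    have hs : sAux b 0 1 = 1 / (1 + b) := by
      rw [sAux, hw']
      field_simp
      ring
    have hpos : 0 < (1 / (1 + b)) ^ (1 - α) := Real.rpow_pos_of_pos (by positivity) _
    rw [hz, hr0, hr, hs, sub_self, Real.zero_rpow (by linarith), Real.one_rpow]
    linarith
  · obtain ⟨q, hq, h⟩ := exists_pos_rpow_mul_rpow_lt hα hb hp
    refine ⟨q, hq, mul_lt_mul_of_pos_left ?_ hc⟩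
    have := mul_nonneg (Real.rpow_nonneg (rAux_mem_Icc hb hp.le hq.le).1 α)
      (Real.rpow_nonneg (sAux_mem_Icc hb hp.le hq.le).1 (1 - α))
    linarith

/-- Lemma 4: for `α < -1`, fixed means `m_P ≠ m_Q` and `σ_P ≥ 0`, letting
`(r', s')` be the binary parameters for `σ_Q = 0` and `(r, s)` those for
`σ_Q > 0`, there exists `σ_Q > 0` with `d_A^{(α)}(r‖s) > d_A^{(α)}(r'‖s')`. -/
theorem binary_alpha_div_exception
    (α : ℝ) (hα : α < -1) (mP mQ σP : ℝ) (hm : mP ≠ mQ) (hσP : 0 ≤ σP) :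
    ∃ σQ : ℝ, 0 < σQ ∧
      dA α (rParam mP mQ σP 0) (sParam mP mQ σP 0)
        < dA α (rParam mP mQ σP σQ) (sParam mP mQ σP σQ) := by
  have ha : 0 < (mP - mQ) ^ 2 := by
    have := sub_ne_zero.2 hm
    positivity
  obtain ⟨q, hq, h⟩ := exists_pos_dA_lt hα ha (sq_nonneg σP)
  refine ⟨√q, Real.sqrt_pos.2 hq, ?_⟩
  rw [dA_rParam_sParam hm, dA_rParam_sParam hm, Real.sq_sqrt hq.le, zero_pow two_ne_zero]
  exact h
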